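/- If p ≥ 1 and p is not an even integer, then the two-dimensional Euclidean space ℓ_2² does not embed linearly isometrically into ℓ_p. -/

import Mathlib

open scoped BigOperators
open Real

namespace EuclLp

noncomputable def c (p : ℝ) (n : ℕ) : ℝ := ∫ t in (-π)..π, |cos t| ^ p * cos (2 * n * t)

lemma cont_f (p : ℝ) (hp : 1 ≤ p) : Continuous (fun t : ℝ => |cos t| ^ p) :=
  (continuous_cos.abs).rpow_const (fun _ => Or.inr (by linarith))

lemma hasDeriv_abs (p : ℝ) (hp : 1 ≤ p) (x : ℝ) :
    HasDerivAt (fun x : ℝ => |x| ^ p * x) ((p + 1) * |x| ^ p) x := by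
  rcases lt_trichotomy x 0 with h | h | h
  · have h1 : HasDerivAt (fun x : ℝ => (-x) ^ p * x)
        ((-1 * p * (-x) ^ (p - 1)) * x + (-x) ^ p * 1) x :=
      (((hasDerivAt_id x).neg).rpow_const (Or.inl (by simpa using h.ne))).mul (hasDerivAt_id x)
    have h2 : (-x) ^ p = (-x) ^ (p - 1) * (-x) := by
      rw [← Real.rpow_add_one (by linarith)]; ring_nf
    have h3 : HasDerivAt (fun x : ℝ => (-x) ^ p * x) ((p + 1) * |x| ^ p) x := by
      convert h1 using 1
      rw [abs_of_neg h, h2]; ring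
    refine h3.congr_of_eventuallyEq ?_
    filter_upwards [eventually_lt_nhds h] with y hy
    rw [abs_of_neg hy]
  · subst h
    have hp0 : p ≠ 0 := by linarith
    rw [hasDerivAt_iff_tendsto_slope]
    have : Filter.Tendsto (fun x : ℝ => |x| ^ p) (nhds 0) (nhds ((p + 1) * |0| ^ p)) := by
      have h := ((continuous_abs (G := ℝ)).rpow_const (p := p)
        (fun _ => Or.inr (by linarith))).tendsto 0
      simpa [Real.zero_rpow hp0] using h
    refine (this.mono_left nhdsWithin_le_nhds).congr' ?_
    filter_upwards [self_mem_nhdsWithin] with y hy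
    have hy : y ≠ 0 := hy
    simp [slope_def_field, hy]
  · have h1 : HasDerivAt (fun x : ℝ => x ^ p * x)
        ((1 * p * x ^ (p - 1)) * x + x ^ p * 1) x :=
      (((hasDerivAt_id x)).rpow_const (Or.inl (by simpa using h.ne'))).mul (hasDerivAt_id x)
    have h2 : x ^ p = x ^ (p - 1) * x := by
      rw [← Real.rpow_add_one (by linarith)]; ring_nf
    have h3 : HasDerivAt (fun x : ℝ => x ^ p * x) ((p + 1) * |x| ^ p) x := by
      convert h1 using 1
      rw [abs_of_pos h, h2]; ring
    refine h3.congr_of_eventuallyEq ?_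
    filter_upwards [eventually_gt_nhds h] with y hy
    rw [abs_of_pos hy]

lemma rec_c (p : ℝ) (hp : 1 ≤ p) (n : ℕ) :
    c p (n + 1) * (p + 2 * n + 2) = c p n * (p - 2 * n) := by
  have hf := cont_f p hp
  have hd : ∀ t : ℝ, HasDerivAt (fun t => (|cos t| ^ p * cos t) * sin ((2 * n + 1) * t))
      (((p + 1) * |cos t| ^ p * (-sin t)) * sin ((2 * n + 1) * t) +
        (|cos t| ^ p * cos t) * (cos ((2 * n + 1) * t) * ((2 * n + 1) * 1))) t := by
    intro t
    exact ((hasDeriv_abs p hp (cos t)).comp t (hasDerivAt_cos t)).mul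
      (((hasDerivAt_id t).const_mul _).sin)
  have hi := intervalIntegral.integral_eq_sub_of_hasDerivAt (a := -π) (b := π)
    (fun t _ => hd t) (Continuous.intervalIntegrable (by fun_prop) _ _)
  have hz : ∀ t : ℝ, ((p + 1) * |cos t| ^ p * (-sin t)) * sin ((2 * n + 1) * t) +
        (|cos t| ^ p * cos t) * (cos ((2 * n + 1) * t) * ((2 * n + 1) * 1))
      = ((p + 2 * n + 2) / 2) * (|cos t| ^ p * cos (2 * (n + 1 : ℕ) * t))
        - ((p - 2 * n) / 2) * (|cos t| ^ p * cos (2 * n * t)) := by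
    intro t
    have e1 : cos (2 * (n + 1 : ℕ) * t) = cos ((2 * n + 1) * t) * cos t - sin ((2 * n + 1) * t) * sin t := by
      rw [← cos_add]; push_cast; ring_nf
    have e2 : cos (2 * n * t) = cos ((2 * n + 1) * t) * cos t + sin ((2 * n + 1) * t) * sin t := by
      rw [← cos_sub]; ring_nf
    rw [e1, e2]; ring
  simp_rw [hz] at hi
  rw [intervalIntegral.integral_sub (Continuous.intervalIntegrable (by fun_prop) _ _)
    (Continuous.intervalIntegrable (by fun_prop) _ _), intervalIntegral.integral_const_mul,
    intervalIntegral.integral_const_mul] at hi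
  change (p + 2 * n + 2) / 2 * c p (n + 1) - (p - 2 * n) / 2 * c p n = _ at hi
  have hs : sin ((2 * n + 1) * π) = 0 := by
    have := sin_nat_mul_pi (2 * n + 1)
    push_cast at this; exact this
  have hs' : sin ((2 * n + 1) * (-π)) = 0 := by
    rw [mul_neg, sin_neg, hs, neg_zero]
  rw [hs, hs'] at hi
  linarith

lemma c_ne (p : ℝ) (hp : 1 ≤ p) (hpe : ¬ ∃ k : ℕ, p = 2 * k) (n : ℕ) : c p n ≠ 0 := by
  induction n with
  | zero =>
    have hf := cont_f p hp
    have : 0 < c p 0 := by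
      unfold c
      refine intervalIntegral.integral_pos (by linarith [pi_pos])
        (Continuous.continuousOn (by fun_prop)) (fun t _ => ?_) ⟨0, ?_, ?_⟩
      · simp; positivity
      · constructor <;> linarith [pi_pos]
      · simp
    exact this.ne'
  | succ n ih =>
    intro h
    have := rec_c p hp n
    rw [h, zero_mul] at this
    rcases mul_eq_zero.mp this.symm with h | h
    · exact ih h
    · exact hpe ⟨n, by linarith⟩

lemma shift (p : ℝ) (hp : 1 ≤ p) (n : ℕ) (ψ : ℝ) :
    ∫ t in (-π)..π, |cos (t - ψ)| ^ p * cos (2 * n * t) = c p n * cos (2 * n * ψ) := by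
  have hf := cont_f p hp
  set g : ℝ → ℝ := fun t => |cos t| ^ p * cos (2 * n * (t + ψ)) with hg
  have hper : Function.Periodic g (2 * π) := by
    intro t
    simp only [hg]
    rw [cos_add_two_pi]
    have : 2 * (n : ℝ) * (t + 2 * π + ψ) = 2 * n * (t + ψ) + (2 * n : ℕ) * (2 * π) := by
      push_cast; ring
    rw [this, cos_add_nat_mul_two_pi]
  have h1 : ∫ t in (-π)..π, |cos (t - ψ)| ^ p * cos (2 * n * t) = ∫ t in (-π)..π, g (t - ψ) := by
    simp [hg]
  rw [h1, intervalIntegral.integral_comp_sub_right]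
  have h2 := hper.intervalIntegral_add_eq (-π - ψ) (-π)
  rw [show -π - ψ + 2 * π = π - ψ by ring, show -π + 2 * π = π by ring] at h2
  rw [h2]
  have h3 : ∀ t, g t = cos (2 * n * ψ) * (|cos t| ^ p * cos (2 * n * t))
      - sin (2 * n * ψ) * (|cos t| ^ p * sin (2 * n * t)) := by
    intro t
    simp only [hg]
    rw [mul_add, cos_add]; ring
  simp_rw [h3]
  rw [intervalIntegral.integral_sub (Continuous.intervalIntegrable (by fun_prop) _ _)
    (Continuous.intervalIntegrable (by fun_prop) _ _), intervalIntegral.integral_const_mul,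
    intervalIntegral.integral_const_mul]
  have h4 : ∫ t in (-π)..π, |cos t| ^ p * sin (2 * n * t) = 0 := by
    have := intervalIntegral.integral_comp_neg (a := -π) (b := π)
      (fun t : ℝ => |cos t| ^ p * sin (2 * n * t))
    simp only [cos_neg, mul_neg, sin_neg, neg_neg, intervalIntegral.integral_neg] at this
    linarith
  rw [h4]; unfold c; ring

lemma coeff (p : ℝ) (hp : 1 ≤ p) (hpe : ¬ ∃ k : ℕ, p = 2 * k) (w ψ : ℕ → ℝ)
    (hw : ∀ j, 0 ≤ w j) (hs : Summable w)
    (h : ∀ t, HasSum (fun j => w j * |cos (t - ψ j)| ^ p) 1) (n : ℕ) (hn : n ≠ 0) :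
    HasSum (fun j => w j * cos (2 * n * ψ j)) 0 := by
  have hf := cont_f p hp
  have hn' : (2 * n : ℝ) ≠ 0 := by positivity
  have key : HasSum (fun j => ∫ t in (-π)..π, w j * |cos (t - ψ j)| ^ p * cos (2 * n * t))
      (∫ t in (-π)..π, 1 * cos (2 * n * t)) := by
    refine intervalIntegral.hasSum_integral_of_dominated_convergence (fun j _ => w j)
      (fun j => ?_) (fun j => ?_) ?_ ?_ ?_
    · have : Continuous (fun t => |cos (t - ψ j)| ^ p) := hf.comp (continuous_sub_right (ψ j))
      exact Continuous.aestronglyMeasurable (by fun_prop)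
    · refine Filter.Eventually.of_forall fun t _ => ?_
      rw [norm_mul, norm_mul, Real.norm_eq_abs, abs_of_nonneg (hw j), Real.norm_eq_abs,
        Real.norm_eq_abs, abs_of_nonneg (by positivity), mul_assoc]
      have h1 : |cos (t - ψ j)| ^ p ≤ 1 :=
        Real.rpow_le_one (abs_nonneg _) (abs_cos_le_one _) (by linarith)
      have h2 := abs_cos_le_one (2 * n * t)
      have h3 : |cos (t - ψ j)| ^ p * |cos (2 * n * t)| ≤ 1 :=
        mul_le_one₀ h1 (abs_nonneg _) h2
      exact mul_le_of_le_one_right (hw j) h3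
    · exact Filter.Eventually.of_forall fun t _ => hs
    · simp
    · exact Filter.Eventually.of_forall fun t _ => (h t).mul_right _
  have e : (∫ t in (-π)..π, 1 * cos (2 * n * t)) = 0 := by
    simp only [one_mul]
    rw [intervalIntegral.integral_comp_mul_left _ hn', integral_cos, mul_neg, sin_neg]
    have := sin_nat_mul_pi (2 * n)
    push_cast at this
    simp [this]
  rw [e] at key
  have key2 := key.mul_left (c p n)⁻¹
  rw [mul_zero] at key2
  refine (congrArg (fun F : ℕ → ℝ => HasSum F 0) (funext fun j => ?_)).mp key2
  simp only [mul_assoc (w j)]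
  rw [intervalIntegral.integral_const_mul, shift p hp]
  have := c_ne p hp hpe n
  field_simp

lemma atom (p : ℝ) (hp : 1 ≤ p) (hpe : ¬ ∃ k : ℕ, p = 2 * k) (w ψ : ℕ → ℝ)
    (hw : ∀ j, 0 ≤ w j) (hs : Summable w)
    (h : ∀ t, HasSum (fun j => w j * |cos (t - ψ j)| ^ p) 1) (k : ℕ) (hk : ψ k = 0) :
    w k = 0 := by
  have hc := coeff p hp hpe w ψ hw hs h
  have hsum : ∀ N : ℕ, HasSum (fun j => ∑ n ∈ Finset.range N, ∑ m ∈ Finset.range N,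
      w j * cos (2 * ((n : ℝ) - m) * ψ j))
      (∑ n ∈ Finset.range N, ∑ m ∈ Finset.range N, if n = m then (∑' j, w j) else 0) := by
    intro N
    refine hasSum_sum fun n _ => hasSum_sum fun m _ => ?_
    rcases lt_trichotomy n m with hnm | hnm | hnm
    · rw [if_neg hnm.ne]
      have := hc (m - n) (by omega)
      rw [Nat.cast_sub hnm.le] at this
      convert this using 3 with j
      rw [← cos_neg]; ring_nf
    · subst hnm
      simpa using hs.hasSum
    · rw [if_neg hnm.ne']
      have := hc (n - m) (by omega)
      rwa [Nat.cast_sub hnm.le] at this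
  have hsq : ∀ (N j : ℕ), ∑ n ∈ Finset.range N, ∑ m ∈ Finset.range N,
      w j * cos (2 * ((n : ℝ) - m) * ψ j) =
      w j * ((∑ n ∈ Finset.range N, cos (2 * n * ψ j)) ^ 2 +
        (∑ n ∈ Finset.range N, sin (2 * n * ψ j)) ^ 2) := by
    intro N j
    rw [sq, sq, Finset.sum_mul_sum, Finset.sum_mul_sum, ← Finset.sum_add_distrib, Finset.mul_sum]
    refine Finset.sum_congr rfl fun n _ => ?_
    rw [← Finset.sum_add_distrib, Finset.mul_sum]
    refine Finset.sum_congr rfl fun m _ => ?_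
    rw [← cos_sub]; ring_nf
  have hN : ∀ N : ℕ, w k * (N : ℝ) ^ 2 ≤ N * ∑' j, w j := by
    intro N
    have h1 := le_hasSum (hsum N) k (fun j _ => by
      rw [hsq]; have := hw j; positivity)
    rw [hsq, hk] at h1
    have h2 : (∑ n ∈ Finset.range N, ∑ m ∈ Finset.range N, if n = m then (∑' j, w j) else 0)
        = N * ∑' j, w j := by
      rw [Finset.sum_congr rfl (g := fun _ => ∑' j, w j)]
      · simp
      · intro n hn
        rw [Finset.sum_ite_eq, if_pos hn]
    rw [h2] at h1
    simpa using h1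
  by_contra hne
  have hpos : 0 < w k := lt_of_le_of_ne (hw k) (Ne.symm hne)
  obtain ⟨N, hN'⟩ := exists_nat_gt ((∑' j, w j) / w k)
  rw [div_lt_iff₀ hpos] at hN'
  have hS : 0 ≤ ∑' j, w j := tsum_nonneg hw
  have hNp : 0 < (N : ℝ) := by
    by_contra hcon
    nlinarith
  have := hN N
  nlinarith

end EuclLp

open EuclLp in
/-- If `p ≥ 1` is not an even integer, then the two-dimensional Euclidean
space `ℓ_2²` does not embed linearly isometrically into `ℓ_p`. -/
theorem euclidean_two_not_embeds_lp
    (p : ℝ) (hp : 1 ≤ p) (hpe : ¬ ∃ k : ℕ, p = 2 * k) :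
    ¬ ∃ T : EuclideanSpace ℝ (Fin 2) →ₗ[ℝ] (ℕ → ℝ),
      ∀ x : EuclideanSpace ℝ (Fin 2),
        Summable (fun j => |T x j| ^ p) ∧ ∑' j, |T x j| ^ p = ‖x‖ ^ p := by
  rintro ⟨T, hT⟩
  have hp0 : p ≠ 0 := by linarith
  set z : ℕ → ℂ := fun j => ⟨T !₂[1, 0] j, T !₂[0, 1] j⟩ with hz
  have hTx : ∀ t j, T !₂[cos t, sin t] j = ‖z j‖ * cos (t - (z j).arg) := by
    intro t j
    have e : (!₂[cos t, sin t] : EuclideanSpace ℝ (Fin 2)) =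
        cos t • !₂[1, 0] + sin t • !₂[0, 1] := by
      ext i; fin_cases i <;> simp
    rw [e, map_add, map_smul, map_smul, cos_sub]
    have h1 := Complex.norm_mul_cos_arg (z j)
    have h2 := Complex.norm_mul_sin_arg (z j)
    have h3 : (z j).re = T !₂[1, 0] j := rfl
    have h4 : (z j).im = T !₂[0, 1] j := rfl
    simp only [Pi.add_apply, Pi.smul_apply, smul_eq_mul]
    rw [← h3, ← h4, ← h1, ← h2]; ring
  have hsum : ∀ t, HasSum (fun j => ‖z j‖ ^ p * |cos (t - (z j).arg)| ^ p) 1 := by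
    intro t
    have h := hT !₂[cos t, sin t]
    have hn : ‖(!₂[cos t, sin t] : EuclideanSpace ℝ (Fin 2))‖ = 1 := by
      simp [EuclideanSpace.norm_eq]
    have h' := h.1.hasSum
    rw [h.2, hn, Real.one_rpow] at h'
    convert h' using 2 with j
    rw [hTx, abs_mul, abs_norm, Real.mul_rpow (norm_nonneg _) (abs_nonneg _)]
  have hs : Summable (fun j => ‖z j‖ ^ p) := by
    have ha := (hT !₂[1, 0]).1
    have hb := (hT !₂[0, 1]).1
    refine Summable.of_nonneg_of_le (fun j => by positivity) (fun j => ?_)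
      ((ha.add hb).mul_left (2 ^ p))
    have h1 : ‖z j‖ ≤ 2 * max |(z j).re| |(z j).im| := by
      have := Complex.norm_le_abs_re_add_abs_im (z j)
      linarith [le_max_left |(z j).re| |(z j).im|, le_max_right |(z j).re| |(z j).im|]
    calc ‖z j‖ ^ p ≤ (2 * max |(z j).re| |(z j).im|) ^ p :=
          Real.rpow_le_rpow (norm_nonneg _) h1 (by linarith)
      _ = 2 ^ p * (max |(z j).re| |(z j).im|) ^ p :=
          Real.mul_rpow (by norm_num) (le_max_of_le_left (abs_nonneg _))
      _ ≤ 2 ^ p * (|(z j).re| ^ p + |(z j).im| ^ p) := by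
          gcongr
          have := Real.rpow_nonneg (abs_nonneg (z j).re) p
          have := Real.rpow_nonneg (abs_nonneg (z j).im) p
          rcases max_choice |(z j).re| |(z j).im| with h | h <;> rw [h] <;> linarith
  have hz0 : ∀ k, ‖z k‖ ^ p = 0 := by
    intro k
    refine atom p hp hpe (fun j => ‖z j‖ ^ p) (fun j => (z j).arg - (z k).arg)
      (fun j => by positivity) hs (fun t => ?_) k (by simp)
    have := hsum (t + (z k).arg)
    convert this using 5 with j
    ring_nf
  have := hsum 0
  simp only [hz0, zero_mul] at this
  exact zero_ne_one (hasSum_zero.unique this)
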